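/- arXiv:math/0409190 — 3 statements merged into one kernel-verified Lean document; each statement's English description precedes it below -/
import Mathlib

section
/- (Dixon's identity) For all nonnegative integers a, b, c, with m = min(a, b, c): ∑_{j=−m}^{m} (−1)^j · C(a+b, a+j) · C(b+c, b+j) · C(c+a, c+j) = (a+b+c)! / (a!·b!·c!), where C(·,·) denotes the binomial coefficient and the summand is zero outside the range −m ≤ j ≤ m (so the sum may equivalently be taken over all integers j with −a ≤ j, −b ≤ j, −c ≤ j and j ≤ a, j ≤ b, j ≤ c). -/
/-- The reciprocal factorial, extended by zero to the negative integers. -/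
def invFactorial (n : ℤ) : ℚ := if 0 ≤ n then ((n.toNat.factorial : ℚ))⁻¹ else 0

lemma invFactorial_of_neg {n : ℤ} (h : n < 0) : invFactorial n = 0 :=
  if_neg (not_le.2 h)

lemma invFactorial_natCast (n : ℕ) : invFactorial n = ((n.factorial : ℚ))⁻¹ := by
  simp [invFactorial]

lemma invFactorial_eq_mul_succ (n : ℤ) :
    invFactorial n = (n + 1) * invFactorial (n + 1) := by
  rcases lt_trichotomy n (-1) with h | rfl | h
  · rw [invFactorial_of_neg (by lia), invFactorial_of_neg (by lia), mul_zero]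
  · rw [invFactorial_of_neg (by lia)]
    simp
  · lift n to ℕ using by lia
    have hs := invFactorial_natCast (n + 1)
    push_cast at hs
    rw [invFactorial_natCast, hs, Nat.factorial_succ]
    push_cast
    field_simp

lemma cast_choose_eq_invFactorial {n : ℕ} {x y : ℤ} (hx : 0 ≤ x) (hy : 0 ≤ y)
    (h : x + y = n) :
    (n.choose x.toNat : ℚ) = n.factorial * invFactorial x * invFactorial y := by
  lift x to ℕ using hx
  lift y to ℕ using hy
  obtain rfl : x + y = n := by exact_mod_cast h
  rw [Int.toNat_natCast, Nat.cast_add_choose, invFactorial_natCast, invFactorial_natCast]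
  field_simp

/-- The summand in Dixon's identity, divided by `(a + b)! (b + c)! (c + a)!`. -/
def dixonTerm (a b c k : ℤ) : ℚ :=
  (k.negOnePow : ℤ) * (invFactorial (a + k) * invFactorial (a - k)) *
    (invFactorial (b + k) * invFactorial (b - k)) * (invFactorial (c + k) * invFactorial (c - k))

lemma dixonTerm_eq_zero {a b c k : ℤ} (h : a < |k| ∨ b < |k| ∨ c < |k|) :
    dixonTerm a b c k = 0 := by
  have key (x : ℤ) (hx : x < |k|) : invFactorial (x + k) * invFactorial (x - k) = 0 := by
    rcases lt_abs.1 hx with hk | hk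
    · rw [invFactorial_of_neg (n := x - k) (by lia), mul_zero]
    · rw [invFactorial_of_neg (n := x + k) (by lia), zero_mul]
  unfold dixonTerm
  rcases h with h | h | h <;> rw [key _ h] <;> ring

/-- The telescoping certificate for the recurrence of Dixon's sum in `a`. -/
def dixonCert (a b c k : ℤ) : ℚ :=
  -(1 / 2) * (k.negOnePow : ℤ) * invFactorial (a + k) * invFactorial (a + 1 - k) *
    invFactorial (b + k - 1) * invFactorial (b - k) *
    invFactorial (c + k - 1) * invFactorial (c - k)

lemma dixonTerm_recurrence (a b c k : ℤ) :
    (a + 1) * (a + b + 1) * (a + c + 1) * dixonTerm (a + 1) b c k -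
      (a + b + c + 1) * dixonTerm a b c k =
    dixonCert a b c (k + 1) - dixonCert a b c k := by
  have h₁ := invFactorial_eq_mul_succ (a + k)
  have h₂ := invFactorial_eq_mul_succ (a - k)
  have h₃ := invFactorial_eq_mul_succ (b + k - 1)
  have h₄ := invFactorial_eq_mul_succ (b - k - 1)
  have h₅ := invFactorial_eq_mul_succ (c + k - 1)
  have h₆ := invFactorial_eq_mul_succ (c - k - 1)
  simp only [dixonTerm, dixonCert, Int.negOnePow_succ]
  rw [show a + 1 + k = a + k + 1 by ring, show a + 1 - k = a - k + 1 by ring,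
    show a + (k + 1) = a + k + 1 by ring, show a + 1 - (k + 1) = a - k by ring,
    show b + (k + 1) - 1 = b + k by ring, show b - (k + 1) = b - k - 1 by ring,
    show c + (k + 1) - 1 = c + k by ring, show c - (k + 1) = c - k - 1 by ring]
  rw [sub_add_cancel] at h₃ h₄ h₅ h₆
  rw [h₁, h₂, h₃, h₄, h₅, h₆]
  push_cast
  ring

lemma sum_Ico_int_sub (f : ℤ → ℚ) (x : ℤ) (n : ℕ) :
    ∑ k ∈ Finset.Ico x (x + n), (f (k + 1) - f k) = f (x + n) - f x := by
  induction n with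
  | zero => simp
  | succ n ih =>
    have : Finset.Ico x (x + (n + 1 : ℕ)) = insert (x + n) (Finset.Ico x (x + n)) := by
      ext k
      simp only [Finset.mem_Ico, Finset.mem_insert]
      lia
    rw [this, Finset.sum_insert (by simp), ih]
    push_cast
    ring_nf

lemma sum_dixonTerm (a b c : ℕ) :
    ∑ k ∈ Finset.Ico (-b : ℤ) (b + 1), dixonTerm a b c k =
      (a + b + c).factorial / (a.factorial * b.factorial * c.factorial *
        ((a + b).factorial * (b + c).factorial * (c + a).factorial)) := by
  induction a with
  | zero =>
    rw [Finset.sum_eq_single 0]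
    · simp only [dixonTerm, add_zero, sub_zero, invFactorial_natCast, zero_add]
      simp
      field_simp
    · intro k _ hk
      exact dixonTerm_eq_zero (.inl (by simpa using hk))
    · intro h
      simp at h
  | succ a ih =>
    have tel := sum_Ico_int_sub (dixonCert a b c) (-b) (2 * b + 1)
    rw [show (-b : ℤ) + (2 * b + 1 : ℕ) = b + 1 by push_cast; ring] at tel
    have hl : dixonCert a b c (-b) = 0 := by
      simp [dixonCert, invFactorial_of_neg]
    have hr : dixonCert a b c (b + 1) = 0 := by
      simp [dixonCert, invFactorial_of_neg]
    rw [hl, hr, sub_zero] at tel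
    simp_rw [← dixonTerm_recurrence] at tel
    rw [Finset.sum_sub_distrib, ← Finset.mul_sum, ← Finset.mul_sum, ih, sub_eq_zero] at tel
    push_cast at tel ⊢
    rw [show a + 1 + b + c = a + b + c + 1 by ring, show a + 1 + b = a + b + 1 by ring,
      show c + (a + 1) = c + a + 1 by ring]
    simp only [Nat.factorial_succ]
    push_cast
    have h : ((a : ℚ) + 1) * (a + b + 1) * (a + c + 1) ≠ 0 := by positivity
    apply mul_left_cancel₀ h
    rw [tel]
    field_simp
    ring

/-- **Dixon's identity.** For nonnegative integers `a, b, c` and `m = min (a, b, c)`,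
`∑_{j=−m}^{m} (−1)^j C(a+b, a+j) C(b+c, b+j) C(c+a, c+j) = (a+b+c)! / (a! b! c!)`. -/
theorem dixon_identity (a b c : ℕ) (m : ℕ) (hm : m = min a (min b c)) :
    ∑ j ∈ Finset.Icc (-(m : ℤ)) (m : ℤ),
        ((j.negOnePow : ℤ) *
          ((a + b).choose (a + j).toNat : ℤ) *
          ((b + c).choose (b + j).toNat : ℤ) *
          ((c + a).choose (c + j).toNat : ℤ)) =
      (Nat.multinomial Finset.univ ![a, b, c] : ℤ) := by
  have hmul : (Nat.multinomial Finset.univ ![a, b, c] : ℚ) =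
      (a + b + c).factorial / (a.factorial * b.factorial * c.factorial) := by
    have h := Nat.multinomial_spec Finset.univ ![a, b, c]
    simp only [Fin.prod_univ_three, Fin.sum_univ_three, Matrix.cons_val] at h
    rw [eq_div_iff (by positivity), mul_comm]
    exact_mod_cast h
  have hext : ∑ j ∈ Finset.Icc (-(m : ℤ)) m, dixonTerm a b c j =
      ∑ j ∈ Finset.Ico (-b : ℤ) (b + 1), dixonTerm a b c j := by
    apply Finset.sum_subset
    · intro j hj
      simp only [Finset.mem_Icc, Finset.mem_Ico] at hj ⊢
      lia
    · intro j _ hj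
      apply dixonTerm_eq_zero
      rw [Finset.mem_Icc, ← abs_le] at hj
      lia
  have hterm : ∀ j ∈ Finset.Icc (-(m : ℤ)) m,
      ((j.negOnePow : ℤ) : ℚ) * (a + b).choose (a + j).toNat * (b + c).choose (b + j).toNat *
        (c + a).choose (c + j).toNat =
      ((a + b).factorial * (b + c).factorial * (c + a).factorial) * dixonTerm a b c j := by
    intro j hj
    rw [Finset.mem_Icc] at hj
    rw [cast_choose_eq_invFactorial (y := b - j) (by lia) (by lia) (by push_cast; ring),
      cast_choose_eq_invFactorial (y := c - j) (by lia) (by lia) (by push_cast; ring),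
      cast_choose_eq_invFactorial (y := a - j) (by lia) (by lia) (by push_cast; ring),
      dixonTerm]
    ring
  rw [← Int.cast_inj (α := ℚ)]
  push_cast
  rw [Finset.sum_congr rfl hterm, ← Finset.mul_sum, hext, sum_dixonTerm, hmul]
  field_simp
end

section
/- Let n ≥ 1, let R be a commutative ring and r ∈ R (equivalently, work in the polynomial ring ℤ[r]). Let M be the n × n matrix (indexed by {0,…,n−1}) whose diagonal entries are all r and whose off-diagonal entries in each row, read from left to right, are n−2, n−3, …, 1, 0; explicitly, M_{ii} = r, M_{ij} = n−2−j for j < i, and M_{ij} = n−1−j for j > i. Then det M = r·(r−1)·(r−2)⋯(r−n+2) · ( r + (n−1)(n−2)/2 ), i.e., det M = (∏_{k=0}^{n−2} (r − k)) · (r + C(n−1,2)). -/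
/-- The sum of `m - 1, m - 2, …, 0`, computed in a ring, is `m.choose 2`. -/
theorem sum_fin_sub_one_sub_cast (R : Type*) [CommRing R] (m : ℕ) :
    ∑ k : Fin m, ((m : R) - 1 - (k : ℕ)) = (m.choose 2 : R) := by
  rw [Fin.sum_univ_eq_sum_range (fun k => (m : R) - 1 - (k : R)) m,
    ← Finset.sum_range_reflect, Nat.choose_two_right,
    ← Finset.sum_range_id, Nat.cast_sum]
  refine Finset.sum_congr rfl fun k hk => ?_
  obtain ⟨d, rfl⟩ := Nat.exists_eq_add_of_lt (Finset.mem_range.mp hk)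
  rw [show k + d + 1 - 1 - k = d by omega]
  push_cast
  ring

/-- A matrix whose rows after the first are multiples of the differences of consecutive standard
basis vectors has determinant the product of the multipliers with the sum of the first row. -/
theorem Matrix.det_of_row_succ_eq_smul_single_sub_single {R : Type*} [CommRing R] {m : ℕ}
    (B : Matrix (Fin (m + 1)) (Fin (m + 1)) R) (a : Fin m → R)
    (hB : ∀ i j, B i.succ j =
      a i * ((if j = i.succ then 1 else 0) - (if j = i.castSucc then 1 else 0))) :
    B.det = (∏ i, a i) * ∑ j, B 0 j := by
  let L : Matrix (Fin (m + 1)) (Fin (m + 1)) R := Matrix.of fun i j => if j ≤ i then 1 else 0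
  have hL : L.det = 1 := by
    rw [Matrix.det_of_isLowerTriangular]
    · simp [L]
    · intro i j hij
      have : i < j := hij
      simp [L, this]
  have h_succ (i : Fin m) (j) : (B * L) i.succ j = if j = i.succ then a i else 0 := by
    simp only [Matrix.mul_apply, hB, L, Matrix.of_apply, mul_assoc, sub_mul, ← Finset.mul_sum,
      Finset.sum_sub_distrib, ite_mul, one_mul, zero_mul, Finset.sum_ite_eq', Finset.mem_univ,
      if_true]
    simp only [Fin.le_def, Fin.ext_iff, Fin.val_succ, Fin.val_castSucc]
    split_ifs <;> first | omega | simp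
  have h_tri : (B * L).BlockTriangular id := by
    intro i j hij
    have hij : j < i := hij
    induction i using Fin.cases with
    | zero => exact absurd hij (Fin.not_lt_zero j)
    | succ i => rw [h_succ, if_neg hij.ne]
  have h_det : (B * L).det = B.det := by rw [Matrix.det_mul, hL, mul_one]
  rw [← h_det, Matrix.det_of_isUpperTriangular h_tri, Fin.prod_univ_succ, mul_comm]
  simp [h_succ, Matrix.mul_apply, L]

/-- The determinant of the `n × n` matrix with diagonal entries `r` and whose
off-diagonal entries in row `i`, read from left to right, are `n−2, n−3, …, 1, 0`
(explicitly `M i j = n−2−j` for `j < i` and `M i j = n−1−j` for `j > i`) equals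
`r (r−1) ⋯ (r−n+2) (r + (n−1)(n−2)/2)`. -/
theorem det_dyson_jacobian_matrix (R : Type*) [CommRing R] (n : ℕ) (hn : 1 ≤ n) (r : R)
    (M : Matrix (Fin n) (Fin n) R)
    (hM : ∀ i j : Fin n, M i j =
      if i = j then r
      else if (j : ℕ) < (i : ℕ) then (((n : ℤ) - 2 - (j : ℕ) : ℤ) : R)
      else (((n : ℤ) - 1 - (j : ℕ) : ℤ) : R)) :
    M.det = (∏ k ∈ Finset.range (n - 1), (r - (k : R))) * (r + ((n - 1).choose 2 : R)) := by
  obtain ⟨m, rfl⟩ := Nat.exists_eq_add_of_le' hn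
  let a : Fin m → R := fun i => r - ((m : R) - 1 - (i : ℕ))
  let B : Matrix (Fin (m + 1)) (Fin (m + 1)) R := Matrix.of <| Fin.cons (M 0) fun i j =>
    a i * ((if j = i.succ then 1 else 0) - (if j = i.castSucc then 1 else 0))
  have h_det : M.det = B.det := by
    refine Matrix.det_eq_of_forall_row_eq_smul_add_pred (fun _ => 1) (fun j => rfl) fun i j => ?_
    simp only [hM, B, a, Matrix.of_apply, Fin.cons_succ, Fin.ext_iff, Fin.val_succ,
      Fin.val_castSucc]
    split_ifs
    all_goals first
      | omega
      | (push_cast; ring1)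
      | (have hj : (j : ℕ) = i + 1 := by omega
         rw [hj]; push_cast; ring1)
      | (have hj : (j : ℕ) = i := by omega
         rw [hj]; push_cast; ring1)
  rw [h_det, Matrix.det_of_row_succ_eq_smul_single_sub_single B a fun i j => rfl,
    Nat.add_sub_cancel]
  congr 1
  · rw [Fin.prod_univ_eq_prod_range (fun k => r - ((m : R) - 1 - (k : R))) m,
      ← Finset.prod_range_reflect]
    refine Finset.prod_congr rfl fun k hk => ?_
    obtain ⟨d, rfl⟩ := Nat.exists_eq_add_of_lt (Finset.mem_range.mp hk)
    rw [show k + d + 1 - 1 - k = d by omega]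
    push_cast
    ring
  · rw [Fin.sum_univ_succ, ← sum_fin_sub_one_sub_cast]
    simp only [B, Matrix.of_apply, Fin.cons_zero, hM]
    congr 1
    refine Finset.sum_congr rfl fun k _ => ?_
    rw [if_neg (Fin.succ_ne_zero k).symm, if_neg (by simp)]
    push_cast [Fin.val_succ]
    ring
end

section
/- Let n ≥ 1 and work in the multivariate polynomial ring ℤ[z₁,…,z_n]. With Δ(z) the Vandermonde determinant and Δ_j(z) the Vandermonde with z_j omitted, for every integer r ≥ 0: (i) if r ≥ n−1 then ∑_{j=1}^n (−1)^{j−1} z_j^r Δ_j(z) = h_{r−n+1}(z₁,…,z_n) · Δ(z), where h_k is the complete homogeneous symmetric polynomial of degree k (h₀ = 1); (ii) if 0 ≤ r ≤ n−2 then ∑_{j=1}^n (−1)^{j−1} z_j^r Δ_j(z) = 0. In particular (r = n−1), ∑_{j=1}^n (−1)^{j−1} z_j^{n−1} Δ_j(z) = Δ(z). -/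
open MvPolynomial in
/-- Splitting off the variable `X none` from a complete homogeneous symmetric polynomial. -/
theorem aeval_hsymm_option_succ {ι R S : Type*} [Fintype ι] [DecidableEq ι] [CommSemiring R]
    [CommSemiring S] [Algebra R S] (v : Option ι → S) (k : ℕ) :
    aeval v (hsymm (Option ι) R (k + 1)) =
      v none * aeval v (hsymm (Option ι) R k) + aeval (fun i => v (some i)) (hsymm ι R (k + 1)) := by
  simp only [hsymm, map_sum, map_multiset_prod, Multiset.map_map, Function.comp_def, aeval_X]
  rw [← (symOptionSuccEquiv (α := ι) (n := k)).symm.sum_comp, Fintype.sum_sum_type,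
    Finset.mul_sum]
  congr 1
  · refine Finset.sum_congr rfl fun s _ => ?_
    change (Multiset.map v (none ::ₘ s.1)).prod = _
    simp
  · refine Finset.sum_congr rfl fun s _ => ?_
    change (Multiset.map v (Multiset.map some s.1)).prod = _
    simp

/-- The divided difference of `x ^ (r + 1)` on `Option ι` in terms of those of `x ^ r`. -/
theorem sum_pow_succ_div_prod_sub_option {ι K : Type*} [Fintype ι] [DecidableEq ι] [Field K]
    {v : Option ι → K} (hv : Function.Injective v) (r : ℕ) :
    ∑ i, v i ^ (r + 1) / ∏ j ∈ Finset.univ.erase i, (v i - v j) =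
      v none * ∑ i, v i ^ r / ∏ j ∈ Finset.univ.erase i, (v i - v j) +
        ∑ i, v (some i) ^ r / ∏ j ∈ Finset.univ.erase i, (v (some i) - v (some j)) := by
  have hprod (i : ι) : ∏ j ∈ Finset.univ.erase (some i), (v (some i) - v j) =
      (v (some i) - v none) * ∏ j ∈ Finset.univ.erase i, (v (some i) - v (some j)) := by
    rw [← Finset.prod_insertNone (fun j => v (some i) - v j)]
    congr 1
    ext (_ | j) <;> simp
  simp only [Fintype.sum_option, hprod, mul_add, Finset.mul_sum, add_assoc,
    ← Finset.sum_add_distrib]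
  congr 1
  · ring
  · refine Finset.sum_congr rfl fun i _ => ?_
    have h₁ : v (some i) - v none ≠ 0 := sub_ne_zero.2 (hv.ne (by simp))
    have h₂ : ∏ j ∈ Finset.univ.erase i, (v (some i) - v (some j)) ≠ 0 :=
      Finset.prod_ne_zero_iff.2 fun j hj =>
        sub_ne_zero.2 (hv.ne (by simpa using (Finset.ne_of_mem_erase hj).symm))
    field_simp
    ring

/-- The divided difference of `x ^ r` vanishes on more than `r + 1` nodes, and is `1` on exactly
`r + 1` nodes. -/
theorem sum_pow_div_prod_sub_of_lt_card {ι K : Type*} [Fintype ι] [DecidableEq ι] [Field K]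
    {v : ι → K} (hv : Function.Injective v) {r : ℕ} (hr : r < Fintype.card ι) :
    ∑ i, v i ^ r / ∏ j ∈ Finset.univ.erase i, (v i - v j) =
      if Fintype.card ι = r + 1 then 1 else 0 := by
  have h := Lagrange.coeff_eq_sum (s := Finset.univ) (hv.injOn) (P := Polynomial.X ^ r)
    (by simpa [Polynomial.degree_X_pow] using hr)
  simp only [Polynomial.eval_pow, Polynomial.eval_X, Polynomial.coeff_X_pow,
    Finset.card_univ] at h
  rw [← h]
  exact if_congr (by omega) rfl rfl

open MvPolynomial in
/-- The divided difference of a power on a finite set of nodes is the complete homogeneous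
symmetric polynomial of complementary degree. -/
theorem sum_pow_div_prod_sub_eq_hsymm {K : Type*} [Field K] (R : Type*) [CommSemiring R]
    [Algebra R K] (ι : Type*) [Fintype ι] [DecidableEq ι] {v : ι → K}
    (hv : Function.Injective v) {r k : ℕ} (h : r + 1 = Fintype.card ι + k) :
    ∑ i, v i ^ r / ∏ j ∈ Finset.univ.erase i, (v i - v j) = aeval v (hsymm ι R k) := by
  revert v r k ‹DecidableEq ι›
  refine Fintype.induction_empty_option (P := fun ι _ => ∀ [DecidableEq ι] {v : ι → K},
    Function.Injective v → ∀ {r k : ℕ}, r + 1 = Fintype.card ι + k →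
      ∑ i, v i ^ r / ∏ j ∈ Finset.univ.erase i, (v i - v j) = aeval v (hsymm ι R k)) ?_ ?_ ?_ ι
  · intro α β _ e ih _ v hv r k h
    let _ : Fintype α := Fintype.ofEquiv β e.symm
    let _ : DecidableEq α := e.decidableEq
    have h' := ih (hv.comp e.injective) (r := r) (k := k) (by rw [h, Fintype.card_congr e])
    rw [← rename_hsymm α R k e, aeval_rename, ← h', ← e.sum_comp]
    refine Finset.sum_congr rfl fun i _ => congrArg _ ?_
    exact (Finset.prod_equiv e (by simp) (by simp)).symm
  · intro _ v _ r k h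
    obtain rfl : k = r + 1 := by simpa using h.symm
    simp [hsymm]
  · intro ι _ ih inst v hv r k h
    classical
    obtain rfl : inst = Option.instDecidableEq := Subsingleton.elim _ _
    induction k generalizing r with
    | zero =>
      rw [sum_pow_div_prod_sub_of_lt_card hv (r := r) (by omega), if_pos (by omega),
        hsymm_zero, map_one]
    | succ k ihk =>
      rw [Fintype.card_option] at h ihk
      obtain ⟨r, rfl⟩ : ∃ r', r = r' + 1 := ⟨r - 1, by omega⟩
      rw [aeval_hsymm_option_succ, ← ihk (r := r) (by omega),
        ← ih (v := fun i => v (some i)) (hv.comp (Option.some_injective _))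
          (r := r) (k := k + 1) (by omega)]
      exact sum_pow_succ_div_prod_sub_option hv r

/-- The Vandermonde product, with the factors involving the index `j` split off. -/
theorem prod_sub_eq_neg_one_pow_mul_prod_omit {n : ℕ} {R : Type*} [CommRing R] (v : Fin n → R)
    (j : Fin n) :
    ∏ p ∈ Finset.univ.filter (fun p : Fin n × Fin n => p.1 < p.2), (v p.1 - v p.2) =
      (-1) ^ (j : ℕ) *
        (∏ p ∈ Finset.univ.filter (fun p : Fin n × Fin n => p.1 < p.2 ∧ p.1 ≠ j ∧ p.2 ≠ j),
          (v p.1 - v p.2)) * ∏ i ∈ Finset.univ.erase j, (v j - v i) := by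
  have hlow : ∏ i ∈ Finset.Iio j, (v i - v j) =
      (-1) ^ (j : ℕ) * ∏ i ∈ Finset.Iio j, (v j - v i) := by
    rw [← Fin.card_Iio j, ← Finset.prod_const, ← Finset.prod_mul_distrib]
    exact Finset.prod_congr rfl fun i _ => by ring
  have herase : Finset.univ.erase j = (Finset.Iio j).disjUnion (Finset.Ioi j)
      (Finset.disjoint_left.2 fun i hi hi' => by simp at hi hi'; order) := by
    ext i
    simp
  have hsplit : Finset.univ.filter (fun p : Fin n × Fin n => p.1 < p.2) =
      Finset.univ.filter (fun p : Fin n × Fin n => p.1 < p.2 ∧ p.1 ≠ j ∧ p.2 ≠ j) ∪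
        ((Finset.Iio j).image (fun i => (i, j)) ∪ (Finset.Ioi j).image (fun i => (j, i))) := by
    ext ⟨a, b⟩
    simp
    grind
  rw [hsplit, Finset.prod_union, Finset.prod_union, Finset.prod_image (by simp),
    Finset.prod_image (by simp), hlow, herase, Finset.prod_disjUnion]
  · ring
  · simp only [Finset.disjoint_left]
    rintro ⟨a, b⟩
    simp
    grind
  · simp only [Finset.disjoint_left]
    rintro ⟨a, b⟩
    simp
    grind

/-- The alternating sum of powers times Vandermonde products with one variable omitted, as a
divided difference. -/
theorem alternating_sum_pow_mul_prod_omit {n : ℕ} {K : Type*} [Field K] {v : Fin n → K}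
    (hv : Function.Injective v) (r : ℕ) :
    ∑ j : Fin n, (-1) ^ (j : ℕ) * v j ^ r *
        (∏ p ∈ Finset.univ.filter (fun p : Fin n × Fin n => p.1 < p.2 ∧ p.1 ≠ j ∧ p.2 ≠ j),
          (v p.1 - v p.2)) =
      (∑ j, v j ^ r / ∏ i ∈ Finset.univ.erase j, (v j - v i)) *
        ∏ p ∈ Finset.univ.filter (fun p : Fin n × Fin n => p.1 < p.2), (v p.1 - v p.2) := by
  rw [Finset.sum_mul]
  refine Finset.sum_congr rfl fun j _ => ?_
  have h : ∏ i ∈ Finset.univ.erase j, (v j - v i) ≠ 0 :=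
    Finset.prod_ne_zero_iff.2 fun i hi => sub_ne_zero.2 (hv.ne (Finset.ne_of_mem_erase hi).symm)
  rw [prod_sub_eq_neg_one_pow_mul_prod_omit v j]
  field_simp


open MvPolynomial in
/-- With `Δ` the Vandermonde determinant in `z₁, …, z_n` and `Δ_j` the Vandermonde
determinant with `z_j` omitted, for every integer `r ≥ 0`:
(i) if `r ≥ n−1` then `∑_{j=1}^n (−1)^{j−1} z_j^r Δ_j = h_{r−n+1}(z₁,…,z_n) · Δ`,
where `h_k` is the complete homogeneous symmetric polynomial; and
(ii) if `0 ≤ r ≤ n−2` then `∑_{j=1}^n (−1)^{j−1} z_j^r Δ_j = 0`. -/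
theorem alt_sum_pow_vandermonde_omit (n : ℕ) (hn : 1 ≤ n) (r : ℕ)
    (Δ : MvPolynomial (Fin n) ℤ)
    (hΔ : Δ = ∏ p ∈ Finset.univ.filter (fun p : Fin n × Fin n => p.1 < p.2),
      (X p.1 - X p.2))
    (Δ' : Fin n → MvPolynomial (Fin n) ℤ)
    (hΔ' : ∀ j, Δ' j = ∏ p ∈ Finset.univ.filter
        (fun p : Fin n × Fin n => p.1 < p.2 ∧ p.1 ≠ j ∧ p.2 ≠ j),
      (X p.1 - X p.2)) :
    (n - 1 ≤ r →
      (∑ j : Fin n, ((-1 : MvPolynomial (Fin n) ℤ)) ^ (j : ℕ) * (X j) ^ r * Δ' j)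
        = hsymm (Fin n) ℤ (r + 1 - n) * Δ)
    ∧ ((r : ℤ) ≤ (n : ℤ) - 2 →
      (∑ j : Fin n, ((-1 : MvPolynomial (Fin n) ℤ)) ^ (j : ℕ) * (X j) ^ r * Δ' j) = 0) := by
  let K := FractionRing (MvPolynomial (Fin n) ℤ)
  let φ : MvPolynomial (Fin n) ℤ →ₐ[ℤ] K := Algebra.algHom ℤ _ K
  have hφ : Function.Injective φ := IsFractionRing.injective (MvPolynomial (Fin n) ℤ) K
  let v : Fin n → K := fun i => φ (X i)
  have hv : Function.Injective v := hφ.comp (X_injective)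
  have hsum : φ (∑ j : Fin n, (-1) ^ (j : ℕ) * X j ^ r * Δ' j) =
      (∑ j, v j ^ r / ∏ i ∈ Finset.univ.erase j, (v j - v i)) * φ Δ := by
    simpa [hΔ, hΔ', v] using alternating_sum_pow_mul_prod_omit hv r
  refine ⟨fun hr => hφ ?_, fun hr => hφ ?_⟩
  · rw [hsum, map_mul, sum_pow_div_prod_sub_eq_hsymm ℤ (Fin n) hv (k := r + 1 - n)
      (by rw [Fintype.card_fin]; omega)]
    exact congrArg (· * φ Δ) (DFunLike.congr_fun (aeval_unique φ) _).symm
  · rw [hsum, sum_pow_div_prod_sub_of_lt_card hv (by rw [Fintype.card_fin]; omega),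
      Fintype.card_fin, if_neg (by omega), zero_mul, map_zero]
end
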